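/- arXiv:2407.21116 — 2 statements merged into one kernel-verified Lean document; each statement's English description precedes it below -/
import Mathlib

section
/- Let n ≥ 3 and let π be a permutation of {1,…,n} that is not 321-avoiding. Then π has a reduced word containing three consecutive entries of the form (i, i+1, i) or of the form (i+1, i, i+1) for some i with 1 ≤ i ≤ n−2 (i.e. some reduced word for π admits a braid move). -/
/-- The simple transposition of the symmetric group on `Fin n` exchanging the
(0-based) positions `i` and `i+1`; it is the identity if `i+1 ≥ n`. -/
def simpleTransposition (n : ℕ) (i : ℕ) : Equiv.Perm (Fin n) :=
  if h : i + 1 < n then Equiv.swap ⟨i, Nat.lt_of_succ_lt h⟩ ⟨i + 1, h⟩ else 1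

/-- The number of inversions of a permutation of `Fin n`: pairs `i < j` with `π i > π j`.
This equals the Coxeter length of `π`. -/
def invCount {n : ℕ} (π : Equiv.Perm (Fin n)) : ℕ :=
  (Finset.univ.filter (fun p : Fin n × Fin n => p.1 < p.2 ∧ π p.2 < π p.1)).card

/-- `w` is a reduced word for `π`: a list of (0-based) indices of simple transpositions
whose product is `π` and whose length is the Coxeter length (number of inversions) of `π`. -/
def IsReducedWord (n : ℕ) (π : Equiv.Perm (Fin n)) (w : List ℕ) : Prop :=
  (∀ i ∈ w, i + 1 < n) ∧ (w.map (simpleTransposition n)).prod = π ∧ w.length = invCount π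

theorem st_val {n : ℕ} (i : ℕ) (h : i + 1 < n) (x : Fin n) :
    ((simpleTransposition n i x : Fin n) : ℕ) =
      if (x : ℕ) = i then i + 1 else if (x : ℕ) = i + 1 then i else x := by
  simp only [simpleTransposition, dif_pos h, Equiv.swap_apply_def, Fin.ext_iff]
  split_ifs <;> rfl

theorem st_st {n : ℕ} (i : ℕ) (h : i + 1 < n) (x : Fin n) :
    simpleTransposition n i (simpleTransposition n i x) = x := by
  simp only [simpleTransposition, dif_pos h, Equiv.swap_apply_self]

theorem st_mul {n : ℕ} (i : ℕ) (h : i + 1 < n) :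
    simpleTransposition n i * simpleTransposition n i = 1 := by
  ext x
  simp [st_st i h]

theorem invCount_descent {n : ℕ} (π : Equiv.Perm (Fin n)) (i : ℕ) (h : i + 1 < n)
    (hd : π ⟨i + 1, h⟩ < π ⟨i, by omega⟩) :
    invCount (π * simpleTransposition n i) + 1 = invCount π := by
  have hmem : ((⟨i, by omega⟩, ⟨i + 1, h⟩) : Fin n × Fin n) ∈
      (Finset.univ.filter (fun p : Fin n × Fin n => p.1 < p.2 ∧ π p.2 < π p.1)) := by
    simp [hd]
  unfold invCount
  rw [← Finset.card_erase_add_one hmem]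
  congr 1
  refine Finset.card_bij' (fun p _ => (simpleTransposition n i p.1, simpleTransposition n i p.2))
    (fun p _ => (simpleTransposition n i p.1, simpleTransposition n i p.2)) ?_ ?_ ?_ ?_
  · rintro ⟨p, q⟩ hp
    simp only [Finset.mem_filter, Finset.mem_univ, true_and, Finset.mem_erase] at hp ⊢
    simp only [Equiv.Perm.mul_apply, ne_eq, Prod.mk.injEq, not_and] at hp ⊢
    obtain ⟨h1, h2⟩ := hp
    have e1 := st_val i h p
    have e2 := st_val i h q
    have key : ¬ ((p : ℕ) = i ∧ (q : ℕ) = i + 1) := by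
      rintro ⟨a, b⟩
      have a' : simpleTransposition n i p = ⟨i + 1, h⟩ := by ext; simp [e1, a]
      have b' : simpleTransposition n i q = ⟨i, by omega⟩ := by ext; simp [e2, b]
      rw [a', b'] at h2
      exact absurd hd (not_lt.2 h2.le)
    refine ⟨?_, ?_, h2⟩
    · simp only [Fin.ext_iff, e1, e2]
      rw [Fin.lt_def] at h1
      split_ifs <;> omega
    · rw [Fin.lt_def] at h1 ⊢
      rw [e1, e2]
      split_ifs <;> omega
  · rintro ⟨p, q⟩ hp
    simp only [Finset.mem_filter, Finset.mem_univ, true_and, Finset.mem_erase] at hp ⊢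
    simp only [Equiv.Perm.mul_apply, ne_eq, Prod.mk.injEq, not_and, st_st i h] at hp ⊢
    obtain ⟨h0, h1, h2⟩ := hp
    refine ⟨?_, h2⟩
    have e1 := st_val i h p
    have e2 := st_val i h q
    simp only [Fin.ext_iff] at h0
    rw [Fin.lt_def] at h1 ⊢
    rw [e1, e2]
    split_ifs <;> omega
  · rintro ⟨p, q⟩ _
    simp [st_st i h]
  · rintro ⟨p, q⟩ _
    simp [st_st i h]

theorem reduced_append {n : ℕ} (π : Equiv.Perm (Fin n)) (i : ℕ) (h : i + 1 < n)
    (hd : π ⟨i + 1, h⟩ < π ⟨i, by omega⟩) (w : List ℕ)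
    (hw : IsReducedWord n (π * simpleTransposition n i) w) :
    IsReducedWord n π (w ++ [i]) := by
  obtain ⟨h1, h2, h3⟩ := hw
  refine ⟨?_, ?_, ?_⟩
  · intro j hj
    rcases List.mem_append.1 hj with hj | hj
    · exact h1 j hj
    · rw [List.mem_singleton.1 hj]; exact h
  · simp [h2, mul_assoc, st_mul i h]
  · simp [h3, invCount_descent π i h hd]

theorem exists_reduced {n : ℕ} (N : ℕ) : ∀ π : Equiv.Perm (Fin n), invCount π = N →
    ∃ w, IsReducedWord n π w := by
  induction N with
  | zero =>
    intro π hπ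
    refine ⟨[], by simp, ?_, by simp [hπ]⟩
    have hm : Monotone π := by
      intro x y hxy
      by_contra hc
      push Not at hc
      have hlt : x < y := lt_of_le_of_ne hxy (by rintro rfl; exact lt_irrefl _ hc)
      unfold invCount at hπ
      rw [Finset.card_eq_zero] at hπ
      have : (x, y) ∈ (∅ : Finset (Fin n × Fin n)) := by
        rw [← hπ]; simp [hlt, hc]
      simp at this
    have hs : StrictMono π := hm.strictMono_of_injective π.injective
    have : hs.orderIsoOfSurjective π π.surjective = OrderIso.refl _ := Subsingleton.elim _ _
    ext x
    have := congrArg (fun f => f x) this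
    simp at this
    simp [this]
  | succ N ih =>
    intro π hπ
    by_cases hd : ∃ i, ∃ h : i + 1 < n, π ⟨i + 1, h⟩ < π ⟨i, by omega⟩
    · obtain ⟨i, h, hd⟩ := hd
      obtain ⟨w, hw⟩ := ih (π * simpleTransposition n i)
        (by have := invCount_descent π i h hd; omega)
      exact ⟨_, reduced_append π i h hd w hw⟩
    · exfalso
      push Not at hd
      have hm : Monotone π := by
        cases n with
        | zero => intro x; exact x.elim0
        | succ n =>
          rw [Fin.monotone_iff_le_succ]
          intro i
          exact hd i (by omega)
      have : invCount π = 0 := by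
        unfold invCount
        rw [Finset.card_eq_zero, Finset.filter_eq_empty_iff]
        rintro ⟨p, q⟩ _ ⟨h1, h2⟩
        exact absurd (hm h1.le) (not_le.2 h2)
      omega

theorem main_aux (n : ℕ) (N : ℕ) : ∀ (π : Equiv.Perm (Fin n)) (a b c : ℕ) (ha : a < n)
    (hb : b < n) (hc : c < n), c - a = N → a < b → b < c → π ⟨b, hb⟩ < π ⟨a, ha⟩ →
    π ⟨c, hc⟩ < π ⟨b, hb⟩ →
    ∃ w : List ℕ, IsReducedWord n π w ∧
      ∃ l₁ l₂ : List ℕ, ∃ i : ℕ, i + 2 < n ∧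
        (w = l₁ ++ i :: (i + 1) :: i :: l₂ ∨ w = l₁ ++ (i + 1) :: i :: (i + 1) :: l₂) := by
  induction N using Nat.strong_induction_on with
  | _ N ih =>
  intro π a b c ha hb hc hN hab hbc h1 h2
  have step : ∀ (i : ℕ) (h : i + 1 < n), π ⟨i + 1, h⟩ < π ⟨i, by omega⟩ →
      (∃ w : List ℕ, IsReducedWord n (π * simpleTransposition n i) w ∧
      ∃ l₁ l₂ : List ℕ, ∃ i : ℕ, i + 2 < n ∧
        (w = l₁ ++ i :: (i + 1) :: i :: l₂ ∨ w = l₁ ++ (i + 1) :: i :: (i + 1) :: l₂)) →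
      ∃ w : List ℕ, IsReducedWord n π w ∧
      ∃ l₁ l₂ : List ℕ, ∃ i : ℕ, i + 2 < n ∧
        (w = l₁ ++ i :: (i + 1) :: i :: l₂ ∨ w = l₁ ++ (i + 1) :: i :: (i + 1) :: l₂) := by
    rintro i h hd ⟨w, hw, l₁, l₂, j, hj, hor⟩
    refine ⟨w ++ [i], reduced_append π i h hd w hw, l₁, l₂ ++ [i], j, hj, ?_⟩
    rcases hor with rfl | rfl
    · left; simp
    · right; simp
  have ev : ∀ (i : ℕ) (h : i + 1 < n) (x y : ℕ) (hx : x < n) (hy : y < n),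
      (y = if x = i then i + 1 else if x = i + 1 then i else x) →
      (π * simpleTransposition n i) ⟨x, hx⟩ = π ⟨y, hy⟩ := by
    intro i h x y hx hy e
    rw [Equiv.Perm.mul_apply]
    congr 1
    ext
    rw [st_val i h]
    exact e.symm
  by_cases hA : a + 1 < b
  · have hlt : a + 1 < n := by omega
    have hne : π ⟨a + 1, hlt⟩ ≠ π ⟨b, hb⟩ := by
      intro e; have := congrArg Fin.val (π.injective e); simp at this; omega
    rcases lt_or_gt_of_ne hne with hx | hx
    · refine step a hlt (hx.trans h1) ?_
      refine ih (c - (a + 1)) (by omega) _ (a + 1) b c hlt hb hc rfl hA hbc ?_ ?_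
      · rw [ev a hlt b b hb hb (by split_ifs <;> omega),
          ev a hlt (a + 1) a hlt ha (by split_ifs <;> omega)]
        exact h1
      · rw [ev a hlt b b hb hb (by split_ifs <;> omega),
          ev a hlt c c hc hc (by split_ifs <;> omega)]
        exact h2
    · exact ih (c - (a + 1)) (by omega) π (a + 1) b c hlt hb hc rfl hA hbc hx h2
  by_cases hC : b + 1 < c
  · obtain ⟨d, rfl⟩ : ∃ d, c = d + 1 := ⟨c - 1, by omega⟩
    have hlt : d < n := by omega
    have hne : π ⟨d, hlt⟩ ≠ π ⟨b, hb⟩ := by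
      intro e; have := congrArg Fin.val (π.injective e); simp at this; omega
    rcases lt_or_gt_of_ne hne with hx | hx
    · exact ih (d - a) (by omega) π a b d ha hb hlt rfl hab (by omega) h1 hx
    · refine step d hc (h2.trans hx) ?_
      refine ih (d - a) (by omega) _ a b d ha hb hlt rfl hab (by omega) ?_ ?_
      · rw [ev d hc b b hb hb (by split_ifs <;> omega),
          ev d hc a a ha ha (by split_ifs <;> omega)]
        exact h1
      · rw [ev d hc b b hb hb (by split_ifs <;> omega),
          ev d hc d (d + 1) hlt hc (by split_ifs <;> omega)]
        exact h2
  obtain rfl : b = a + 1 := by omega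
  obtain rfl : c = a + 1 + 1 := by omega
  obtain ⟨w, hw⟩ := exists_reduced _ (π * simpleTransposition n a * simpleTransposition n (a + 1) *
    simpleTransposition n a) rfl
  have sv : ∀ (i : ℕ) (h : i + 1 < n) (x y : ℕ) (hx : x < n) (hy : y < n),
      (y = if x = i then i + 1 else if x = i + 1 then i else x) →
      simpleTransposition n i ⟨x, hx⟩ = ⟨y, hy⟩ := by
    intro i h x y hx hy e
    ext
    rw [st_val i h]
    exact e.symm
  have r0 := sv a hb a (a + 1) ha hb (by split_ifs <;> omega)
  have r1 := sv a hb (a + 1) a hb ha (by split_ifs <;> omega)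
  have r2 := sv a hb (a + 1 + 1) (a + 1 + 1) hc hc (by split_ifs <;> omega)
  have t0 := sv (a + 1) hc a a ha ha (by split_ifs <;> omega)
  have t1 := sv (a + 1) hc (a + 1) (a + 1 + 1) hb hc (by split_ifs <;> omega)
  have t2 := sv (a + 1) hc (a + 1 + 1) (a + 1) hc hb (by split_ifs <;> omega)
  have w1 := reduced_append (π * simpleTransposition n a * simpleTransposition n (a + 1)) a hb
    (by simp only [Equiv.Perm.mul_apply, r0, r1, r2, t0, t1, t2]; exact h2) w hw
  have w2 := reduced_append (π * simpleTransposition n a) (a + 1) hc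
    (by simp only [Equiv.Perm.mul_apply, r0, r1, r2]; exact h2.trans h1) _ w1
  have w3 := reduced_append π a hb h1 _ w2
  exact ⟨_, w3, w, [], a, hc, Or.inl (by simp)⟩

/-- For `n ≥ 3`, if a permutation `π` of `{1,…,n}` is not 321-avoiding
(there are indices `a < b < c` with `π a > π b > π c`), then some reduced word for
`π` contains three consecutive entries of the form `(i, i+1, i)` or `(i+1, i, i+1)`
(with both indices valid, i.e. `i + 2 < n` in 0-based indexing); that is, some reduced
word for `π` admits a braid move. -/
theorem exists_braid_move_of_not_avoiding321 (n : ℕ) (hn : 3 ≤ n)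
    (π : Equiv.Perm (Fin n))
    (h : ∃ a b c : Fin n, a < b ∧ b < c ∧ π b < π a ∧ π c < π b) :
    ∃ w : List ℕ, IsReducedWord n π w ∧
      ∃ l₁ l₂ : List ℕ, ∃ i : ℕ, i + 2 < n ∧
        (w = l₁ ++ i :: (i + 1) :: i :: l₂ ∨ w = l₁ ++ (i + 1) :: i :: (i + 1) :: l₂) := by
  obtain ⟨a, b, c, hab, hbc, h1, h2⟩ := h
  exact main_aux n _ π a b c a.2 b.2 c.2 rfl hab hbc h1 h2
end

section
/- Let D be a reduced rectangular pipe dream of shape a×b that is rigid. If (i,j) ∈ D is a cross such that some position (i',j) with i' > i is an elbow (i.e. (i',j) ∉ D), then every position (i,j') with j' < j is a cross, i.e. the crosses extend from (i,j) all the way west to the left wall. The same statement holds with the four compass directions rotated: with south and west replaced by west and south, by north and east, or by east and north, respectively. -/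
/-- A rectangular pipe dream of shape `a × b`: a set of crosses `D` inside the grid
`{1,…,a} × {1,…,b}` (first coordinate = row, from top to bottom; second = column,
from left to right).  Positions of the grid not in `D` are elbows. -/
def IsPipeDream (a b : ℕ) (D : Finset (ℕ × ℕ)) : Prop :=
  D ⊆ Finset.Icc 1 a ×ˢ Finset.Icc 1 b

/-- The reading word of a rectangular pipe dream of shape `a × b`: read the rows from
bottom (`i = a`) to top (`i = 1`), each row from left (`j = 1`) to right (`j = b`);
a cross at `(i,j)` contributes the simple transposition `s_{i+j-1}` of `S_{a+b}`
(recorded here by its 0-based index `i + j - 2 = (i-1) + (j-1)`). -/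
def readingWord (a b : ℕ) (D : Finset (ℕ × ℕ)) : List ℕ :=
  ((List.range a).reverse.flatMap fun r =>
    (List.range b).filterMap fun c =>
      if (r + 1, c + 1) ∈ D then some (r + c) else none)

/-- The permutation of a rectangular pipe dream: the product of its reading word. -/
def pdPerm (a b : ℕ) (D : Finset (ℕ × ℕ)) : Equiv.Perm (Fin (a + b)) :=
  ((readingWord a b D).map (simpleTransposition (a + b))).prod

/-- A pipe dream is reduced if the Coxeter length of its permutation equals its number
of crosses. -/
def IsReducedPD (a b : ℕ) (D : Finset (ℕ × ℕ)) : Prop :=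
  invCount (pdPerm a b D) = D.card

/-- A reduced rectangular pipe dream is rigid if it is the unique reduced rectangular
pipe dream of its shape with its permutation. -/
def IsRigid (a b : ℕ) (D : Finset (ℕ × ℕ)) : Prop :=
  ∀ D' : Finset (ℕ × ℕ), IsPipeDream a b D' → IsReducedPD a b D' →
    pdPerm a b D' = pdPerm a b D → D' = D

def pdCell (n : ℕ) (D : Finset (ℕ × ℕ)) (r c : ℕ) : Equiv.Perm (Fin n) :=
  if (r + 1, c + 1) ∈ D then simpleTransposition n (r + c) else 1

def pdSeg (n : ℕ) (D : Finset (ℕ × ℕ)) (r m l : ℕ) : Equiv.Perm (Fin n) :=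
  ((List.range' m l).map (pdCell n D r)).prod

def pdRows (n b : ℕ) (D : Finset (ℕ × ℕ)) (m l : ℕ) : Equiv.Perm (Fin n) :=
  ((List.range' m l).reverse.map (fun r => pdSeg n D r 0 b)).prod

theorem pdSeg_succ (n : ℕ) (D : Finset (ℕ × ℕ)) (r m l : ℕ) :
    pdSeg n D r m (l + 1) = pdCell n D r m * pdSeg n D r (m + 1) l := by
  simp [pdSeg, List.range'_succ]

theorem pdSeg_add (n : ℕ) (D : Finset (ℕ × ℕ)) (r m l k : ℕ) :
    pdSeg n D r m (l + k) = pdSeg n D r m l * pdSeg n D r (m + l) k := by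
  rw [pdSeg, pdSeg, pdSeg, ← List.range'_append_1, List.map_append, List.prod_append]

theorem pdRows_add (n b : ℕ) (D : Finset (ℕ × ℕ)) (m l k : ℕ) :
    pdRows n b D m (l + k) = pdRows n b D (m + l) k * pdRows n b D m l := by
  rw [pdRows, pdRows, pdRows, ← List.range'_append_1, List.reverse_append, List.map_append,
    List.prod_append]

theorem pdRows_one (n b : ℕ) (D : Finset (ℕ × ℕ)) (m : ℕ) :
    pdRows n b D m 1 = pdSeg n D m 0 b := by
  simp [pdRows]

theorem pdPerm_eq (a b : ℕ) (D : Finset (ℕ × ℕ)) :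
    pdPerm a b D = pdRows (a + b) b D 0 a := by
  unfold pdPerm readingWord pdRows
  rw [← List.range_eq_range']
  generalize (List.range a).reverse = L
  induction L with
  | nil => simp
  | cons r L ih =>
    rw [List.flatMap_cons, List.map_append, List.prod_append, ih, List.map_cons, List.prod_cons]
    congr 1
    unfold pdSeg
    rw [← List.range_eq_range']
    generalize List.range b = M
    induction M with
    | nil => simp
    | cons c M ih2 =>
      rw [List.map_cons, List.prod_cons, ← ih2]
      by_cases h : (r + 1, c + 1) ∈ D <;> simp [pdCell, h]

def PMaps {n : ℕ} (π : Equiv.Perm (Fin n)) (u v : ℕ) : Prop :=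
  ∀ x : Fin n, x.val = u → (π x).val = v

theorem PMaps.mul {n : ℕ} {π ρ : Equiv.Perm (Fin n)} {u v w : ℕ}
    (h1 : PMaps ρ v w) (h2 : PMaps π u v) : PMaps (ρ * π) u w :=
  fun x hx => h1 _ (h2 x hx)

theorem PMaps.one {n : ℕ} (u : ℕ) : PMaps (1 : Equiv.Perm (Fin n)) u u := fun _ hx => hx

theorem PMaps.st_fix {n k u : ℕ} (h : u ≠ k) (h' : u ≠ k + 1) :
    PMaps (simpleTransposition n k) u u := by
  intro x hx
  unfold simpleTransposition
  split_ifs with hk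
  · rw [Equiv.swap_apply_of_ne_of_ne]
    · exact hx
    · intro e; apply h; rw [← hx, e]
    · intro e; apply h'; rw [← hx, e]
  · exact hx

theorem PMaps.st_up {n k : ℕ} (hk : k + 1 < n) :
    PMaps (simpleTransposition n k) k (k + 1) := by
  intro x hx
  have : x = ⟨k, Nat.lt_of_succ_lt hk⟩ := Fin.ext hx
  subst this
  simp [simpleTransposition, hk]

theorem PMaps.st_down {n k : ℕ} (hk : k + 1 < n) :
    PMaps (simpleTransposition n k) (k + 1) k := by
  intro x hx
  have : x = ⟨k + 1, hk⟩ := Fin.ext hx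
  subst this
  simp [simpleTransposition, hk]

theorem PMaps.cell_fix {n : ℕ} {D : Finset (ℕ × ℕ)} {r c u : ℕ} (h : u ≠ r + c)
    (h' : u ≠ r + c + 1) : PMaps (pdCell n D r c) u u := by
  unfold pdCell
  split_ifs
  · exact PMaps.st_fix h h'
  · exact PMaps.one u

theorem PMaps.seg_fix {n : ℕ} {D : Finset (ℕ × ℕ)} {r u : ℕ} (l m : ℕ)
    (h : u < r + m ∨ r + m + l < u) : PMaps (pdSeg n D r m l) u u := by
  induction l generalizing m with
  | zero => exact PMaps.one u
  | succ l ih =>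
    rw [pdSeg_succ]
    exact (PMaps.cell_fix (by omega) (by omega)).mul (ih (m + 1) (by omega))

theorem PMaps.seg_down {n : ℕ} {D : Finset (ℕ × ℕ)} {r : ℕ} (l m : ℕ) (hn : r + m + l < n)
    (h : ∀ c, m ≤ c → c < m + l → (r + 1, c + 1) ∈ D) :
    PMaps (pdSeg n D r m l) (r + m + l) (r + m) := by
  induction l generalizing m with
  | zero => exact PMaps.one _
  | succ l ih =>
    rw [pdSeg_succ]
    have h1 := ih (m + 1) (by omega) (fun c h1 h2 => h c (by omega) (by omega))
    have h2 : PMaps (pdCell n D r m) (r + m + 1) (r + m) := by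
      rw [pdCell, if_pos (h m le_rfl (by omega))]
      exact PMaps.st_down (by omega)
    have := h2.mul h1
    rwa [show r + (m + 1) + l = r + m + (l + 1) by omega] at this

theorem PMaps.row_up {n b : ℕ} {D : Finset (ℕ × ℕ)} {r c : ℕ} (hn : r + c + 1 < n)
    (hc : c < b) (h : (r + 1, c + 1) ∈ D) :
    PMaps (pdSeg n D r 0 b) (r + c) (r + c + 1) := by
  obtain ⟨k, rfl⟩ : ∃ k, b = c + (k + 1) := ⟨b - c - 1, by omega⟩
  rw [pdSeg_add, pdSeg_succ, pdCell, zero_add, if_pos h]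
  exact (PMaps.seg_fix _ _ (by omega)).mul ((PMaps.st_up hn).mul (PMaps.seg_fix _ _ (by omega)))

theorem PMaps.rows_up {n b : ℕ} {D : Finset (ℕ × ℕ)} {c : ℕ} (hc : c < b) (l m : ℕ)
    (hn : m + l + c < n)
    (h : ∀ r, m ≤ r → r < m + l → (r + 1, c + 1) ∈ D) :
    PMaps (pdRows n b D m l) (m + c) (m + l + c) := by
  induction l with
  | zero => exact PMaps.one _
  | succ l ih =>
    rw [pdRows_add, pdRows_one]
    have h1 := ih (by omega) (fun r h1 h2 => h r h1 (by omega))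
    have h2 : PMaps (pdSeg n D (m + l) 0 b) (m + l + c) (m + l + c + 1) :=
      PMaps.row_up (by omega) hc (h _ (by omega) (by omega))
    have := h2.mul h1
    rwa [show m + l + c + 1 = m + (l + 1) + c by omega] at this

theorem st_conj {n k k' : ℕ} {B : Equiv.Perm (Fin n)} (hk : k + 1 < n) (hk' : k' + 1 < n)
    (h1 : PMaps B k' k) (h2 : PMaps B (k' + 1) (k + 1)) :
    simpleTransposition n k * B = B * simpleTransposition n k' := by
  rw [simpleTransposition, simpleTransposition, dif_pos hk, dif_pos hk',
    Equiv.mul_swap_eq_swap_mul]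
  congr 2
  · exact Fin.ext (h1 _ rfl).symm
  · exact Fin.ext (h2 _ rfl).symm

theorem st_mul_self (n k : ℕ) : simpleTransposition n k * simpleTransposition n k = 1 := by
  unfold simpleTransposition
  split_ifs <;> simp

def pdMid (n b : ℕ) (D : Finset (ℕ × ℕ)) (r1 r2 c1 c2 : ℕ) : Equiv.Perm (Fin n) :=
  pdSeg n D r2 (c1 + 1) (b - c1 - 1) * pdRows n b D (r1 + 1) (r2 - r1 - 1) * pdSeg n D r1 0 c2

theorem pdPerm_split (a b : ℕ) (D : Finset (ℕ × ℕ)) {r1 r2 c1 c2 : ℕ} (hr : r1 < r2)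
    (hr2 : r2 < a) (hc : c1 < c2) (hc2 : c2 < b) :
    pdPerm a b D = (pdRows (a + b) b D (r2 + 1) (a - r2 - 1) * pdSeg (a + b) D r2 0 c1) *
      pdCell (a + b) D r2 c1 * pdMid (a + b) b D r1 r2 c1 c2 * pdCell (a + b) D r1 c2 *
      (pdSeg (a + b) D r1 (c2 + 1) (b - c2 - 1) * pdRows (a + b) b D 0 r1) := by
  rw [pdPerm_eq]
  generalize a + b = n
  have e1 : pdRows n b D 0 a = pdRows n b D (r2 + 1) (a - r2 - 1) * (pdSeg n D r2 0 b *
      (pdRows n b D (r1 + 1) (r2 - r1 - 1) * (pdSeg n D r1 0 b * pdRows n b D 0 r1))) := by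
    conv_lhs => rw [show a = r1 + (1 + ((r2 - r1 - 1) + (1 + (a - r2 - 1)))) by omega]
    simp only [pdRows_add, pdRows_one, zero_add]
    rw [show r1 + 1 + (r2 - r1 - 1) = r2 by omega]
    simp only [mul_assoc]
  have e2 : ∀ r c, c < b → pdSeg n D r 0 b =
      pdSeg n D r 0 c * (pdCell n D r c * pdSeg n D r (c + 1) (b - c - 1)) := by
    intro r c h
    conv_lhs => rw [show b = c + ((b - c - 1) + 1) by omega]
    rw [pdSeg_add, pdSeg_succ, zero_add]
  rw [e1, e2 r2 c1 (by omega), e2 r1 c2 hc2, pdMid]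
  simp only [mul_assoc]

theorem pdSeg_congr (n : ℕ) {D D' : Finset (ℕ × ℕ)} {r m l : ℕ}
    (h : ∀ c, m ≤ c → c < m + l → ((r + 1, c + 1) ∈ D ↔ (r + 1, c + 1) ∈ D')) :
    pdSeg n D r m l = pdSeg n D' r m l := by
  unfold pdSeg
  congr 1
  apply List.map_congr_left
  intro c hc
  rw [List.mem_range'_1] at hc
  simp only [pdCell, h c hc.1 hc.2]

theorem pdRows_congr (n b : ℕ) {D D' : Finset (ℕ × ℕ)} {m l : ℕ}
    (h : ∀ r c, m ≤ r → r < m + l → ((r + 1, c + 1) ∈ D ↔ (r + 1, c + 1) ∈ D')) :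
    pdRows n b D m l = pdRows n b D' m l := by
  unfold pdRows
  congr 1
  apply List.map_congr_left
  intro r hr
  rw [List.mem_reverse, List.mem_range'_1] at hr
  exact pdSeg_congr n (fun c _ _ => h r c hr.1 hr.2)

theorem pdMid_conj (a b : ℕ) (D : Finset (ℕ × ℕ)) {r1 r2 c1 c2 : ℕ} (hr : r1 < r2)
    (hr2 : r2 < a) (hc : c1 < c2) (hc2 : c2 < b)
    (hNW : (r1 + 1, c1 + 1) ∉ D) (hSE : (r2 + 1, c2 + 1) ∉ D)
    (hT : ∀ c, c1 < c → c < c2 → (r1 + 1, c + 1) ∈ D)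
    (hB : ∀ c, c1 < c → c < c2 → (r2 + 1, c + 1) ∈ D)
    (hL : ∀ r, r1 < r → r < r2 → (r + 1, c1 + 1) ∈ D)
    (hR : ∀ r, r1 < r → r < r2 → (r + 1, c2 + 1) ∈ D) :
    simpleTransposition (a + b) (r2 + c1) * pdMid (a + b) b D r1 r2 c1 c2 =
      pdMid (a + b) b D r1 r2 c1 c2 * simpleTransposition (a + b) (r1 + c2) := by
  have hn : ∀ r c, r ≤ r2 → c ≤ c2 → r + c + 1 < a + b := by intros; omega
  generalize a + b = n at hn
  have t1 : PMaps (pdSeg n D r1 0 c2) (r1 + c2) (r1 + 1 + c1) := by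
    rw [show c2 = c1 + ((c2 - c1 - 1) + 1) by omega, pdSeg_add, pdSeg_succ, zero_add, pdCell,
      if_neg hNW, one_mul]
    refine (PMaps.seg_fix _ _ (by omega)).mul ?_
    have := PMaps.seg_down (n := n) (D := D) (r := r1) (c2 - c1 - 1) (c1 + 1)
      (by have := hn r1 c2 (by omega) le_rfl; omega)
      (fun c _ _ => hT c (by omega) (by omega))
    convert this using 1 <;> omega
  have t2 : PMaps (pdSeg n D r1 0 c2) (r1 + c2 + 1) (r1 + 1 + c2) := by
    rw [show r1 + 1 + c2 = r1 + c2 + 1 by omega]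
    exact PMaps.seg_fix _ _ (by omega)
  have m1 : PMaps (pdRows n b D (r1 + 1) (r2 - r1 - 1)) (r1 + 1 + c1) (r2 + c1) := by
    have := PMaps.rows_up (n := n) (b := b) (D := D) (c := c1) (by omega) (r2 - r1 - 1) (r1 + 1)
      (by have := hn r2 c1 le_rfl (by omega); omega) (fun r _ _ => hL r (by omega) (by omega))
    rwa [show r1 + 1 + (r2 - r1 - 1) = r2 by omega] at this
  have m2 : PMaps (pdRows n b D (r1 + 1) (r2 - r1 - 1)) (r1 + 1 + c2) (r2 + c2) := by
    have := PMaps.rows_up (n := n) (b := b) (D := D) (c := c2) (by omega) (r2 - r1 - 1) (r1 + 1)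
      (by have := hn r2 c2 le_rfl (by omega); omega) (fun r _ _ => hR r (by omega) (by omega))
    rwa [show r1 + 1 + (r2 - r1 - 1) = r2 by omega] at this
  have b1 : PMaps (pdSeg n D r2 (c1 + 1) (b - c1 - 1)) (r2 + c1) (r2 + c1) :=
    PMaps.seg_fix _ _ (by omega)
  have b2 : PMaps (pdSeg n D r2 (c1 + 1) (b - c1 - 1)) (r2 + c2) (r2 + c1 + 1) := by
    rw [show b - c1 - 1 = (c2 - c1 - 1) + ((b - c2 - 1) + 1) by omega, pdSeg_add, pdSeg_succ,
      show c1 + 1 + (c2 - c1 - 1) = c2 by omega, pdCell, if_neg hSE, one_mul]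
    refine PMaps.mul ?_ (PMaps.seg_fix _ _ (by omega))
    have := PMaps.seg_down (n := n) (D := D) (r := r2) (c2 - c1 - 1) (c1 + 1)
      (by have := hn r2 c2 (by omega) le_rfl; omega)
      (fun c _ _ => hB c (by omega) (by omega))
    convert this using 1 <;> omega
  exact st_conj (hn _ _ le_rfl (by omega)) (hn _ _ (by omega) le_rfl)
    ((b1.mul m1).mul t1) ((b2.mul m2).mul t2)

theorem invCount_st_mul {n : ℕ} (k : ℕ) (π : Equiv.Perm (Fin n)) :
    invCount (simpleTransposition n k * π) ≤ invCount π + 1 := by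
  unfold simpleTransposition
  split_ifs with hk
  · unfold invCount
    refine le_trans (Finset.card_le_card (t := insert
      (π.symm ⟨k, Nat.lt_of_succ_lt hk⟩, π.symm ⟨k + 1, hk⟩) _) ?_) (Finset.card_insert_le _ _)
    rintro ⟨p, q⟩ h
    rw [Finset.mem_filter] at h
    rw [Finset.mem_insert, Finset.mem_filter]
    simp only [Finset.mem_univ, true_and, Equiv.Perm.mul_apply,
      Finset.mem_insert, Prod.mk.injEq, Equiv.eq_symm_apply] at h ⊢
    obtain ⟨h1, h2⟩ := h
    have hne : π p ≠ π q := fun e => h1.ne (π.injective e)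
    by_cases h3 : π q < π p
    · exact Or.inr ⟨h1, h3⟩
    · left
      generalize π p = x at *
      generalize π q = y at *
      simp only [Equiv.swap_apply_def] at h2
      simp only [Fin.ext_iff, Fin.lt_def, ne_eq] at *
      split_ifs at h2 <;> simp at * <;> omega
  · simp

theorem invCount_word {n : ℕ} (L : List ℕ) :
    invCount (L.map (simpleTransposition n)).prod ≤ L.length := by
  induction L with
  | nil =>
    simp only [List.map_nil, List.prod_nil, List.length_nil, invCount, Nat.le_zero,
      Finset.card_eq_zero]
    ext ⟨p, q⟩
    rw [Finset.mem_filter]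
    simp
    exact fun h => h.le
  | cons k L ih =>
    rw [List.map_cons, List.prod_cons, List.length_cons]
    exact (invCount_st_mul k _).trans (by omega)

theorem readingWord_length (a b : ℕ) (D : Finset (ℕ × ℕ)) :
    (readingWord a b D).length ≤ D.card := by
  have e : readingWord a b D = (((List.range a).reverse.flatMap fun r =>
      (List.range b).filterMap fun c =>
      if (r + 1, c + 1) ∈ D then some (r + 1, c + 1) else none)).map
        (fun x => x.1 + x.2 - 2) := by
    unfold readingWord
    rw [List.map_flatMap]
    congr 1
    funext r
    rw [List.map_filterMap]
    congr 1
    funext c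
    split_ifs
    · simp; omega
    · simp
  rw [e, List.length_map, ← List.toFinset_card_of_nodup]
  · apply Finset.card_le_card
    intro x hx
    simp only [List.mem_toFinset, List.mem_flatMap, List.mem_filterMap] at hx
    obtain ⟨r, _, c, _, h⟩ := hx
    split_ifs at h with h'
    · simp at h; rwa [← h]
  · rw [List.nodup_flatMap]
    constructor
    · intro r _
      apply List.Nodup.filterMap _ List.nodup_range
      intro c c' x h h'
      simp only [Option.mem_def] at h h'
      split_ifs at h h'
      · simp at h h'
        have := h.trans h'.symm
        simp at this; exact this
    · have : (List.range a).reverse.Nodup := List.nodup_reverse.2 List.nodup_range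
      refine List.Pairwise.imp ?_ this
      intro r r' hne x h h'
      simp only [List.mem_filterMap] at h h'
      obtain ⟨c, _, h⟩ := h
      obtain ⟨c', _, h'⟩ := h'
      split_ifs at h h'
      · simp at h h'
        have := h.trans h'.symm
        simp at this; exact hne this.1

theorem rect_contra (a b : ℕ) (D : Finset (ℕ × ℕ))
    (hpd : IsPipeDream a b D) (hred : IsReducedPD a b D) (hrig : IsRigid a b D)
    {r1 r2 c1 c2 : ℕ} (hr : r1 < r2)
    (hr2 : r2 < a) (hc : c1 < c2) (hc2 : c2 < b)
    (hNW : (r1 + 1, c1 + 1) ∉ D) (hSE : (r2 + 1, c2 + 1) ∉ D)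
    (hT : ∀ c, c1 < c → c < c2 → (r1 + 1, c + 1) ∈ D)
    (hB : ∀ c, c1 < c → c < c2 → (r2 + 1, c + 1) ∈ D)
    (hL : ∀ r, r1 < r → r < r2 → (r + 1, c1 + 1) ∈ D)
    (hR : ∀ r, r1 < r → r < r2 → (r + 1, c2 + 1) ∈ D) :
    (r1 + 1, c2 + 1) ∉ D ∧ (r2 + 1, c1 + 1) ∉ D := by
  have conj := pdMid_conj a b D hr hr2 hc hc2 hNW hSE hT hB hL hR
  have split := fun D' => pdPerm_split a b D' hr hr2 hc hc2
  have key : ∀ D' : Finset (ℕ × ℕ), (∀ r c, (r, c) ≠ (r1, c2) → (r, c) ≠ (r2, c1) →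
      ((r + 1, c + 1) ∈ D' ↔ (r + 1, c + 1) ∈ D)) →
      pdPerm a b D' = (pdRows (a + b) b D (r2 + 1) (a - r2 - 1) * pdSeg (a + b) D r2 0 c1) *
      pdCell (a + b) D' r2 c1 * pdMid (a + b) b D r1 r2 c1 c2 * pdCell (a + b) D' r1 c2 *
      (pdSeg (a + b) D r1 (c2 + 1) (b - c2 - 1) * pdRows (a + b) b D 0 r1) := by
    intro D' h
    have h' : ∀ r c, (r ≠ r1 ∨ c ≠ c2) → (r ≠ r2 ∨ c ≠ c1) →
      ((r + 1, c + 1) ∈ D' ↔ (r + 1, c + 1) ∈ D) := by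
      intro r c h1 h2
      apply h
      · simp only [ne_eq, Prod.mk.injEq]; omega
      · simp only [ne_eq, Prod.mk.injEq]; omega
    rw [split D', pdMid, pdMid,
      pdRows_congr (a + b) b (D := D') (D' := D) (m := r2 + 1)
        (fun r c _ _ => h' r c (by omega) (by omega)),
      pdRows_congr (a + b) b (D := D') (D' := D) (m := r1 + 1)
        (fun r c _ _ => h' r c (by omega) (by omega)),
      pdRows_congr (a + b) b (D := D') (D' := D) (m := 0)
        (fun r c _ _ => h' r c (by omega) (by omega)),
      pdSeg_congr (a + b) (D := D') (D' := D) (r := r2) (m := 0)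
        (fun c _ _ => h' _ c (by omega) (by omega)),
      pdSeg_congr (a + b) (D := D') (D' := D) (r := r2) (m := c1 + 1)
        (fun c _ _ => h' _ c (by omega) (by omega)),
      pdSeg_congr (a + b) (D := D') (D' := D) (r := r1) (m := 0)
        (fun c _ _ => h' _ c (by omega) (by omega)),
      pdSeg_congr (a + b) (D := D') (D' := D) (r := r1) (m := c2 + 1)
        (fun c _ _ => h' _ c (by omega) (by omega))]
  generalize pdRows (a + b) b D (r2 + 1) (a - r2 - 1) * pdSeg (a + b) D r2 0 c1 = A at key
  generalize pdSeg (a + b) D r1 (c2 + 1) (b - c2 - 1) * pdRows (a + b) b D 0 r1 = C at key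
  generalize pdMid (a + b) b D r1 r2 c1 c2 = B at key conj
  have hDD := key D (fun _ _ _ _ => Iff.rfl)
  have nemq : ((r1 + 1, c2 + 1) : ℕ × ℕ) ≠ (r2 + 1, c1 + 1) := by
    simp only [ne_eq, Prod.mk.injEq]; omega
  have swapcase : ∀ x y : ℕ × ℕ, x ∈ D → y ∉ D → y ∈ Finset.Icc 1 a ×ˢ Finset.Icc 1 b →
      pdPerm a b (insert y (D.erase x)) = pdPerm a b D → False := by
    intro x y hx hy hy' hp
    have := hrig (insert y (D.erase x)) ?_ ?_ hp
    · exact hy (this ▸ Finset.mem_insert_self _ _)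
    · intro z hz
      rcases Finset.mem_insert.1 hz with rfl | hz
      · exact hy'
      · exact hpd (Finset.mem_of_mem_erase hz)
    · rw [IsReducedPD, hp, hred, Finset.card_insert_of_notMem
        (fun h => hy (Finset.mem_of_mem_erase h)), Finset.card_erase_add_one hx]
  by_cases h1 : (r1 + 1, c2 + 1) ∈ D <;> by_cases h2 : (r2 + 1, c1 + 1) ∈ D
  · exfalso
    set E := (D.erase (r1 + 1, c2 + 1)).erase (r2 + 1, c1 + 1) with hE
    have hEp := key E (by
      intro r c g1 g2
      simp only [ne_eq, Prod.mk.injEq] at g1 g2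
      simp [hE, g1, g2])
    have n1 : (r1 + 1, c2 + 1) ∉ E := by simp [hE]
    have n2 : (r2 + 1, c1 + 1) ∉ E := by simp [hE]
    rw [pdCell, pdCell, if_pos h1, if_pos h2, mul_assoc A, conj, mul_assoc A, mul_assoc B,
      st_mul_self, mul_one] at hDD
    rw [pdCell, pdCell, if_neg n1, if_neg n2, mul_one, mul_one, ← hDD] at hEp
    have l1 : invCount (pdPerm a b E) ≤ E.card :=
      (invCount_word (readingWord a b E)).trans (readingWord_length a b E)
    have l2 : E.card < D.card := by
      apply Finset.card_lt_card
      refine ⟨fun z hz => Finset.mem_of_mem_erase (Finset.mem_of_mem_erase hz), fun h => n1 (h h1)⟩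
    rw [hEp, hred] at l1
    omega
  · exfalso
    refine swapcase _ _ h1 h2 (by simp; omega) ?_
    rw [key, hDD]
    · rw [pdCell, pdCell, pdCell, pdCell, if_pos h1, if_neg h2, if_pos (by simp),
        if_neg (by simp [nemq]), mul_assoc A, conj]
      simp only [mul_assoc, mul_one, one_mul]
    · intro r c g1 g2
      simp only [ne_eq, Prod.mk.injEq] at g1 g2
      simp [g1, g2]
  · exfalso
    refine swapcase _ _ h2 h1 (by simp; omega) ?_
    rw [key, hDD]
    · have k1 : pdCell (a + b) (insert (r1 + 1, c2 + 1) (D.erase (r2 + 1, c1 + 1))) r2 c1 = 1 :=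
        if_neg (by simp [nemq.symm])
      have k2 : pdCell (a + b) (insert (r1 + 1, c2 + 1) (D.erase (r2 + 1, c1 + 1))) r1 c2 =
        simpleTransposition (a + b) (r1 + c2) := if_pos (by simp)
      rw [k1, k2, pdCell, pdCell, if_pos h2, if_neg h1, mul_assoc A (simpleTransposition (a + b) (r2 + c1)) B, conj]
      simp only [mul_assoc, mul_one, one_mul]
    · intro r c g1 g2
      simp only [ne_eq, Prod.mk.injEq] at g1 g2
      simp [g1, g2]
  · exact ⟨h1, h2⟩

theorem no_SW (a b : ℕ) (D : Finset (ℕ × ℕ))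
    (hpd : IsPipeDream a b D) (hred : IsReducedPD a b D) (hrig : IsRigid a b D) (N : ℕ) :
    ∀ r1 r2 c1 c2 : ℕ, (r2 - r1) + (c2 - c1) = N → r1 < r2 → r2 < a → c1 < c2 → c2 < b →
    (r1 + 1, c1 + 1) ∉ D → (r2 + 1, c2 + 1) ∉ D → (r1 + 1, c2 + 1) ∉ D := by
  induction N using Nat.strong_induction_on with
  | _ N ih =>
  intro r1 r2 c1 c2 hN hr hr2 hc hc2 hNW hSE hNE
  have hT : ∀ c, c1 < c → c < c2 → (r1 + 1, c + 1) ∈ D := by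
    intro c _ _
    by_contra h
    exact ih _ (by omega) r1 r2 c c2 rfl hr hr2 (by omega) hc2 h hSE hNE
  have hR : ∀ r, r1 < r → r < r2 → (r + 1, c2 + 1) ∈ D := by
    intro r _ _
    by_contra h
    exact ih _ (by omega) r1 r c1 c2 rfl (by omega) (by omega) hc hc2 hNW h hNE
  have hB : ∀ c, c1 < c → c < c2 → (r2 + 1, c + 1) ∈ D := by
    intro c h1 h2
    by_contra h
    exact ih _ (by omega) r1 r2 c1 c rfl hr hr2 h1 (by omega) hNW h (hT c h1 h2)
  have hL : ∀ r, r1 < r → r < r2 → (r + 1, c1 + 1) ∈ D := by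
    intro r h1 h2
    by_contra h
    exact ih _ (by omega) r r2 c1 c2 rfl h2 hr2 hc hc2 h hSE (hR r h1 h2)
  exact (rect_contra a b D hpd hred hrig hr hr2 hc hc2 hNW hSE hT hB hL hR).1 hNE

theorem no_NE (a b : ℕ) (D : Finset (ℕ × ℕ))
    (hpd : IsPipeDream a b D) (hred : IsReducedPD a b D) (hrig : IsRigid a b D) (N : ℕ) :
    ∀ r1 r2 c1 c2 : ℕ, (r2 - r1) + (c2 - c1) = N → r1 < r2 → r2 < a → c1 < c2 → c2 < b →
    (r1 + 1, c1 + 1) ∉ D → (r2 + 1, c2 + 1) ∉ D → (r2 + 1, c1 + 1) ∉ D := by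
  induction N using Nat.strong_induction_on with
  | _ N ih =>
  intro r1 r2 c1 c2 hN hr hr2 hc hc2 hNW hSE hSW
  have hB : ∀ c, c1 < c → c < c2 → (r2 + 1, c + 1) ∈ D := by
    intro c _ _
    by_contra h
    exact ih _ (by omega) r1 r2 c1 c rfl hr hr2 (by omega) (by omega) hNW h hSW
  have hL : ∀ r, r1 < r → r < r2 → (r + 1, c1 + 1) ∈ D := by
    intro r _ _
    by_contra h
    exact ih _ (by omega) r r2 c1 c2 rfl (by omega) (by omega) hc hc2 h hSE hSW
  have hT : ∀ c, c1 < c → c < c2 → (r1 + 1, c + 1) ∈ D := by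
    intro c h1 h2
    by_contra h
    exact ih _ (by omega) r1 r2 c c2 rfl hr hr2 h2 hc2 h hSE (hB c h1 h2)
  have hR : ∀ r, r1 < r → r < r2 → (r + 1, c2 + 1) ∈ D := by
    intro r h1 h2
    by_contra h
    exact ih _ (by omega) r1 r c1 c2 rfl h1 (by omega) hc hc2 hNW h (hL r h1 h2)
  exact (rect_contra a b D hpd hred hrig hr hr2 hc hc2 hNW hSE hT hB hL hR).2 hSW

/-- Let `D` be a rigid reduced rectangular pipe dream of shape `a × b`.
If a cross `(i,j) ∈ D` has an elbow `(i',j)` somewhere to its south, then the crosses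
extend from `(i,j)` all the way west to the left wall; and likewise in the three other
rotated versions (west elbow → crosses all the way south, north elbow → crosses all the
way east, east elbow → crosses all the way north). -/
theorem rigid_cross_extends_to_wall (a b : ℕ) (D : Finset (ℕ × ℕ))
    (hpd : IsPipeDream a b D) (hred : IsReducedPD a b D) (hrig : IsRigid a b D) :
    (∀ i j i' : ℕ, (i, j) ∈ D → i < i' → i' ≤ a → (i', j) ∉ D →
      ∀ j', 1 ≤ j' → j' < j → (i, j') ∈ D) ∧
    (∀ i j j' : ℕ, (i, j) ∈ D → 1 ≤ j' → j' < j → (i, j') ∉ D →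
      ∀ i', i < i' → i' ≤ a → (i', j) ∈ D) ∧
    (∀ i j i' : ℕ, (i, j) ∈ D → 1 ≤ i' → i' < i → (i', j) ∉ D →
      ∀ j', j < j' → j' ≤ b → (i, j') ∈ D) ∧
    (∀ i j j' : ℕ, (i, j) ∈ D → j < j' → j' ≤ b → (i, j') ∉ D →
      ∀ i', 1 ≤ i' → i' < i → (i', j) ∈ D) := by
  have hb : ∀ i j, (i, j) ∈ D → 1 ≤ i ∧ i ≤ a ∧ 1 ≤ j ∧ j ≤ b := by
    intro i j h
    have := hpd h
    simp at this
    omega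
  have main1 : ∀ r1 r2 c1 c2 : ℕ, (r1, c2) ∈ D → r1 < r2 → r2 ≤ a → 1 ≤ c1 → c1 < c2 →
      (r1, c1) ∉ D → (r2, c2) ∉ D → False := by
    intro r1 r2 c1 c2 h h1 h2 h3 h4 h5 h6
    have := hb _ _ h
    obtain ⟨r1, rfl⟩ : ∃ k, r1 = k + 1 := ⟨r1 - 1, by omega⟩
    obtain ⟨r2, rfl⟩ : ∃ k, r2 = k + 1 := ⟨r2 - 1, by omega⟩
    obtain ⟨c1, rfl⟩ : ∃ k, c1 = k + 1 := ⟨c1 - 1, by omega⟩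
    obtain ⟨c2, rfl⟩ : ∃ k, c2 = k + 1 := ⟨c2 - 1, by omega⟩
    exact no_SW a b D hpd hred hrig _ r1 r2 c1 c2 rfl (by omega) (by omega) (by omega) (by omega)
      h5 h6 h
  have main2 : ∀ r1 r2 c1 c2 : ℕ, (r2, c1) ∈ D → 1 ≤ r1 → r1 < r2 → c1 < c2 → c2 ≤ b →
      (r1, c1) ∉ D → (r2, c2) ∉ D → False := by
    intro r1 r2 c1 c2 h h1 h2 h3 h4 h5 h6
    have := hb _ _ h
    obtain ⟨r1, rfl⟩ : ∃ k, r1 = k + 1 := ⟨r1 - 1, by omega⟩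
    obtain ⟨r2, rfl⟩ : ∃ k, r2 = k + 1 := ⟨r2 - 1, by omega⟩
    obtain ⟨c1, rfl⟩ : ∃ k, c1 = k + 1 := ⟨c1 - 1, by omega⟩
    obtain ⟨c2, rfl⟩ : ∃ k, c2 = k + 1 := ⟨c2 - 1, by omega⟩
    exact no_NE a b D hpd hred hrig _ r1 r2 c1 c2 rfl (by omega) (by omega) (by omega) (by omega)
      h5 h6 h
  refine ⟨?_, ?_, ?_, ?_⟩
  · intro i j i' h h1 h2 h3 j' h4 h5
    by_contra h6
    exact main1 _ _ _ _ h h1 h2 h4 h5 h6 h3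
  · intro i j j' h h1 h2 h3 i' h4 h5
    by_contra h6
    exact main1 _ _ _ _ h h4 h5 h1 h2 h3 h6
  · intro i j i' h h1 h2 h3 j' h4 h5
    by_contra h6
    exact main2 _ _ _ _ h h1 h2 h4 h5 h3 h6
  · intro i j j' h h1 h2 h3 i' h4 h5
    by_contra h6
    exact main2 _ _ _ _ h h4 h5 h1 h2 h6 h3
end
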